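/- There is an absolute constant C > 0 with the following property. Let ψ: ℕ → ℝ be non-negative and let m ≠ n be positive integers with 0 < ψ(m) ≤ 1/2 and 0 < ψ(n) ≤ 1/2. With r, t defined from the prime factorizations of m and n (r = ∏_{u_p=v_p} p^{u_p}, t = ∏_{u_p≠v_p} p^{max(u_p,v_p)}), Δ = max(ψ(m)/m, ψ(n)/n), and S_t(θ) = (1/θ)·#{1 ≤ b ≤ θ : gcd(b,t) = 1}, one has λ(E_m(ψ) ∩ E_n(ψ)) / (λ(E_m(ψ))·λ(E_n(ψ))) ≤ C · (t/φ(t)) · (1/(Δrt)) · ∫_1^{max(1, 4Δrt)} S_t(θ) dθ. -/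

import Mathlib

open MeasureTheory Filter Finset

/-- The set `E_n(ψ) ⊆ ℝ/ℤ`, the union over `1 ≤ a ≤ n`, `gcd(a,n)=1`, of the
intervals `((a-ψ(n))/n, (a+ψ(n))/n)` taken mod 1. -/
noncomputable def E (ψ : ℕ → ℝ) (n : ℕ) : Set UnitAddCircle :=
  ⋃ a ∈ (Finset.Icc 1 n).filter (fun a => Nat.Coprime a n),
    (fun y : ℝ => (y : UnitAddCircle)) '' Set.Ioo (((a : ℝ) - ψ n) / n) (((a : ℝ) + ψ n) / n)

/-- `W(ψ)`: points of the circle lying in infinitely many sets `E_n(ψ)`. -/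
noncomputable def W (ψ : ℕ → ℝ) : Set UnitAddCircle := {x | ∃ᶠ n in atTop, x ∈ E ψ n}

/-- `log x` understood as `max (1, log x)`. -/
noncomputable def flog (x : ℝ) : ℝ := max 1 (Real.log x)

/-- `S_t(θ) = (1/θ) · #{1 ≤ b ≤ θ : (b,t)=1}`. -/
noncomputable def S (t : ℕ) (θ : ℝ) : ℝ :=
  (((Finset.Icc 1 ⌊θ⌋₊).filter (fun b => Nat.Coprime b t)).card : ℝ) / θ

lemma aux_prod_bound (K : ℕ) : ∏ k ∈ Finset.Icc 2 (K+1), ((k:ℝ)^2/((k:ℝ)^2-1)) ≤ 2 * ((K:ℝ)+1)/((K:ℝ)+2) := by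
  induction K with
  | zero => simp
  | succ K ih =>
    rw [Finset.prod_Icc_succ_top (by omega)]
    have h0 : (0:ℝ) ≤ K := by positivity
    have h1 : (((K+1+1:ℕ):ℝ)^2/(((K+1+1:ℕ):ℝ)^2-1)) = (K+2)^2/((K+1)*(K+3)) := by
      push_cast; congr 1 <;> ring
    rw [h1]
    calc _ ≤ (2 * ((K:ℝ)+1)/(K+2)) * ((K+2)^2/((K+1)*(K+3))) := by gcongr
      _ ≤ _ := by
        apply le_of_eq
        push_cast
        field_simp
        ring

lemma aux_primes_bound (s : Finset ℕ) (hs : ∀ p ∈ s, p.Prime) :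
    ∏ p ∈ s, ((p:ℝ)^2/((p:ℝ)^2-1)) ≤ 2 := by
  have hsub : s ⊆ Finset.Icc 2 (s.sup id + 1) := by
    intro p hp
    have := Finset.le_sup (f := id) hp
    exact Finset.mem_Icc.2 ⟨(hs p hp).two_le, le_trans this (Nat.le_succ _)⟩
  have h1 : ∀ k : ℕ, 2 ≤ k → (1:ℝ) ≤ (k:ℝ)^2/((k:ℝ)^2-1) := by
    intro k hk
    have : (2:ℝ) ≤ k := by exact_mod_cast hk
    rw [le_div_iff₀ (by nlinarith)]; linarith
  calc _ ≤ ∏ k ∈ Finset.Icc 2 (s.sup id+1), ((k:ℝ)^2/((k:ℝ)^2-1)) := by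
        apply Finset.prod_le_prod_of_subset_of_one_le hsub
        · intro i hi; exact zero_le_one.trans (h1 i (hs i hi).two_le)
        · intro i hi _; exact h1 i (Finset.mem_Icc.1 hi).1
    _ ≤ _ := aux_prod_bound _
    _ ≤ 2 := by
      rw [div_le_iff₀ (by positivity)]; nlinarith

lemma aux_L1 (c : ℕ) (hc : 0 < c) :
    ∏ p ∈ c.primeFactors, ((p:ℝ)/((p:ℝ)-1)) ≤ 2 * ∑ d ∈ c.divisors, (1:ℝ)/d := by
  have e : ∏ p ∈ c.primeFactors, ((p:ℝ)/((p:ℝ)-1)) =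
      (∏ p ∈ c.primeFactors, ((p:ℝ)^2/((p:ℝ)^2-1))) * ∏ p ∈ c.primeFactors, ((1:ℝ)/p+1) := by
    rw [← Finset.prod_mul_distrib]
    apply Finset.prod_congr rfl
    intro p hp
    have : (2:ℝ) ≤ p := by exact_mod_cast (Nat.prime_of_mem_primeFactors hp).two_le
    have h1 : (p:ℝ) - 1 ≠ 0 := by linarith
    have h2 : (p:ℝ)^2 - 1 ≠ 0 := by nlinarith
    have h3 : (p:ℝ) ≠ 0 := by linarith
    field_simp
    ring
  have h2 : ∏ p ∈ c.primeFactors, ((1:ℝ)/p+1) ≤ ∑ d ∈ c.divisors, (1:ℝ)/d := by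
    rw [Finset.prod_add_one]
    have hinj : Set.InjOn (fun s : Finset ℕ => ∏ p ∈ s, p) (c.primeFactors.powerset : Set (Finset ℕ)) := by
      intro s hs s' hs' h
      simp only [Finset.coe_powerset, Set.mem_preimage, Set.mem_powerset_iff, Finset.coe_subset] at hs hs'
      have a1 := Nat.primeFactors_prod (s := s) (fun p hp => Nat.prime_of_mem_primeFactors (hs hp))
      have a2 := Nat.primeFactors_prod (s := s') (fun p hp => Nat.prime_of_mem_primeFactors (hs' hp))
      simp only at h
      rw [← a1, ← a2, h]
    calc _ = ∑ d ∈ c.primeFactors.powerset.image (fun s : Finset ℕ => ∏ p ∈ s, p), (1:ℝ)/d := by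
          rw [Finset.sum_image hinj]
          apply Finset.sum_congr rfl
          intro s hs
          push_cast
          simp
      _ ≤ _ := by
        apply Finset.sum_le_sum_of_subset_of_nonneg
        · intro d hd
          obtain ⟨s, hs, rfl⟩ := Finset.mem_image.1 hd
          rw [Nat.mem_divisors]
          refine ⟨?_, hc.ne'⟩
          exact (Finset.prod_dvd_prod_of_subset _ _ _ (Finset.mem_powerset.1 hs)).trans (Nat.prod_primeFactors_dvd c)
        · intros; positivity
  rw [e]
  have h3 := aux_primes_bound c.primeFactors (fun p hp => Nat.prime_of_mem_primeFactors hp)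
  have h4 : 0 ≤ ∏ p ∈ c.primeFactors, ((1:ℝ)/p+1) := by positivity
  nlinarith

lemma aux_div_sum (t N : ℕ) :
    ∑ c ∈ (Finset.Icc 1 N).filter (fun c => Nat.Coprime c t), ∑ d ∈ c.divisors, (1:ℝ)/d ≤
    ∑ e ∈ (Finset.Icc 1 N).filter (fun c => Nat.Coprime c t), ∑ d ∈ Finset.Icc 1 (N/e), (1:ℝ)/d := by
  rw [Finset.sum_sigma', Finset.sum_sigma']
  have hinj : Set.InjOn (fun x : (_ : ℕ) × ℕ => (⟨x.1/x.2, x.2⟩ : (_ : ℕ) × ℕ))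
     ((((Finset.Icc 1 N).filter (fun c => Nat.Coprime c t)).sigma (fun c => c.divisors) : Finset ((_ : ℕ) × ℕ)) : Set ((_ : ℕ) × ℕ)) := by
    rintro ⟨c,d⟩ h ⟨c',d'⟩ h' heq
    simp only [Finset.coe_sigma, Set.mem_sigma_iff, Finset.mem_coe, Nat.mem_divisors] at h h'
    simp only [Sigma.mk.injEq, heq_eq_eq] at heq
    obtain ⟨h1, rfl⟩ := heq
    have : c = c' := by
      rw [← Nat.div_mul_cancel h.2.1, h1, Nat.div_mul_cancel h'.2.1]
    subst this; rfl
  calc _ = ∑ x ∈ ((((Finset.Icc 1 N).filter (fun c => Nat.Coprime c t)).sigma (fun c => c.divisors) : Finset ((_ : ℕ) × ℕ)).image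
        (fun x : (_ : ℕ) × ℕ => (⟨x.1/x.2, x.2⟩ : (_ : ℕ) × ℕ))), (1:ℝ)/x.2 := by
        rw [Finset.sum_image hinj]
    _ ≤ _ := by
      apply Finset.sum_le_sum_of_subset_of_nonneg
      · intro x hx
        obtain ⟨⟨c,d⟩, h, rfl⟩ := Finset.mem_image.1 hx
        simp only [Finset.mem_sigma, Finset.mem_filter, Finset.mem_Icc, Nat.mem_divisors] at h ⊢
        obtain ⟨⟨⟨h1, h2⟩, h3⟩, ⟨k, rfl⟩, h5⟩ := h
        have hd : 0 < d := Nat.pos_of_ne_zero (by rintro rfl; simp at h5)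
        have hk : 0 < k := Nat.pos_of_ne_zero (by rintro rfl; simp at h5)
        rw [Nat.mul_div_cancel_left _ hd]
        refine ⟨⟨⟨hk, ?_⟩, ?_⟩, hd, ?_⟩
        · nlinarith
        · exact Nat.Coprime.coprime_mul_left h3
        · rw [Nat.le_div_iff_mul_le hk]; exact h2
      · intros; positivity

lemma aux_S_int (t : ℕ) (a b : ℝ) (ha : 0 < a) (hab : a ≤ b) : IntervalIntegrable (S t) volume a b := by
  unfold S
  have hm : Monotone (fun θ : ℝ => (((Finset.Icc 1 ⌊θ⌋₊).filter (fun b => Nat.Coprime b t)).card : ℝ)) := by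
    intro x y hxy
    simp only [Nat.cast_le]
    apply Finset.card_le_card
    apply Finset.filter_subset_filter
    apply Finset.Icc_subset_Icc_right
    exact Nat.floor_le_floor hxy
  simp only [div_eq_mul_inv]
  apply IntervalIntegrable.mul_continuousOn hm.intervalIntegrable
  apply ContinuousOn.inv₀ continuousOn_id
  intro x hx
  rw [Set.uIcc_of_le hab] at hx
  exact (ha.trans_le hx.1).ne'

lemma aux_ind (e Y : ℝ) (he : 1 ≤ e) (hY : e ≤ Y) :
    IntervalIntegrable (fun θ : ℝ => (if e ≤ θ then (1:ℝ) else 0) * θ⁻¹) volume 1 Y ∧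
    Real.log (Y/e) ≤ ∫ θ in (1:ℝ)..Y, (if e ≤ θ then (1:ℝ) else 0) * θ⁻¹ := by
  have hm : Monotone (fun θ : ℝ => if e ≤ θ then (1:ℝ) else 0) := by
    intro x y hxy
    simp only
    split_ifs <;> linarith
  have hI : ∀ a b : ℝ, 1 ≤ a → a ≤ b → IntervalIntegrable (fun θ : ℝ => (if e ≤ θ then (1:ℝ) else 0) * θ⁻¹) volume a b := by
    intro a b ha hab
    apply IntervalIntegrable.mul_continuousOn hm.intervalIntegrable
    apply ContinuousOn.inv₀ continuousOn_id
    intro x hx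
    rw [Set.uIcc_of_le hab] at hx
    exact (zero_lt_one.trans_le (ha.trans hx.1)).ne'
  refine ⟨hI _ _ le_rfl (he.trans hY), ?_⟩
  rw [← intervalIntegral.integral_add_adjacent_intervals (hI 1 e le_rfl he) (hI e Y he hY)]
  have h1 : 0 ≤ ∫ θ in (1:ℝ)..e, (if e ≤ θ then (1:ℝ) else 0) * θ⁻¹ := by
    apply intervalIntegral.integral_nonneg he
    intro u hu
    have : 0 < u := by linarith [hu.1]
    split_ifs <;> positivity
  have h2 : ∫ θ in e..Y, (if e ≤ θ then (1:ℝ) else 0) * θ⁻¹ = Real.log (Y/e) := by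
    rw [← integral_inv_of_pos (by linarith) (by linarith)]
    apply intervalIntegral.integral_congr
    intro x hx
    rw [Set.uIcc_of_le hY] at hx
    simp [hx.1]
  linarith

lemma aux_L2 (t : ℕ) (X : ℝ) (hX : 0 ≤ X) :
    Real.log 2 * ∑ c ∈ (Finset.Icc 1 ⌊X⌋₊).filter (fun c => Nat.Coprime c t), ∑ d ∈ c.divisors, (1:ℝ)/d ≤
    ∫ θ in (1:ℝ)..(max 1 (2*X)), S t θ := by
  have hl2 : 0 < Real.log 2 := Real.log_pos (by norm_num)
  have hl1 : Real.log 2 ≤ 1 := by have := Real.log_two_lt_d9; linarith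
  by_cases hX1 : X < 1
  · rw [Nat.floor_eq_zero.2 hX1]
    simp only [Finset.Icc_eq_empty_of_lt zero_lt_one, Finset.filter_empty, Finset.sum_empty, mul_zero]
    apply intervalIntegral.integral_nonneg (le_max_left _ _)
    intro u hu
    have : 0 < u := by linarith [hu.1]
    unfold S; positivity
  push Not at hX1
  have hY : max 1 (2*X) = 2*X := max_eq_right (by linarith)
  rw [hY]
  set Sc := (Finset.Icc 1 ⌊X⌋₊).filter (fun c => Nat.Coprime c t) with hSc
  have hmem : ∀ e ∈ Sc, (1:ℝ) ≤ e ∧ (e:ℝ) ≤ X := by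
    intro e he
    simp only [hSc, Finset.mem_filter, Finset.mem_Icc] at he
    refine ⟨by exact_mod_cast he.1.1, ?_⟩
    exact (Nat.cast_le.2 he.1.2).trans (Nat.floor_le hX)
  have hind := fun e (he : e ∈ Sc) => aux_ind (e:ℝ) (2*X) (hmem e he).1 (by linarith [(hmem e he).2])
  calc _ ≤ Real.log 2 * ∑ e ∈ Sc, ∑ d ∈ Finset.Icc 1 (⌊X⌋₊/e), (1:ℝ)/d := by
        exact mul_le_mul_of_nonneg_left (aux_div_sum t _) hl2.le
    _ = ∑ e ∈ Sc, Real.log 2 * ∑ d ∈ Finset.Icc 1 (⌊X⌋₊/e), (1:ℝ)/d := by rw [Finset.mul_sum]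
    _ ≤ ∑ e ∈ Sc, Real.log (2*X/e) := by
        apply Finset.sum_le_sum
        intro e he
        obtain ⟨h1, h2⟩ := hmem e he
        have he0 : (0:ℝ) < e := by linarith
        have hh := harmonic_floor_le_one_add_log (X/e) (by rw [le_div_iff₀ he0]; linarith)
        rw [Nat.floor_div_natCast, harmonic_eq_sum_Icc] at hh
        push_cast at hh
        simp only [one_div]
        have : Real.log (2*X/e) = Real.log 2 + Real.log (X/e) := by
          rw [mul_div_assoc, Real.log_mul (by norm_num) (by positivity)]
        rw [this]
        have h3 : 0 ≤ Real.log (X/e) := Real.log_nonneg (by rw [le_div_iff₀ he0]; linarith)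
        nlinarith
    _ ≤ ∑ e ∈ Sc, ∫ θ in (1:ℝ)..(2*X), (if (e:ℝ) ≤ θ then (1:ℝ) else 0) * θ⁻¹ :=
        Finset.sum_le_sum fun e he => (hind e he).2
    _ = ∫ θ in (1:ℝ)..(2*X), ∑ e ∈ Sc, (if (e:ℝ) ≤ θ then (1:ℝ) else 0) * θ⁻¹ := by
        rw [intervalIntegral.integral_finsetSum]
        exact fun e he => (hind e he).1
    _ ≤ _ := by
        apply intervalIntegral.integral_mono_on (by linarith)
        · have := IntervalIntegrable.sum Sc fun e he => (hind e he).1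
          rw [← Finset.sum_fn]; exact this
        · exact aux_S_int t _ _ zero_lt_one (by linarith)
        · intro x hx
          have hx0 : 0 < x := by linarith [hx.1]
          rw [← Finset.sum_mul, Finset.sum_boole]
          unfold S
          rw [div_eq_mul_inv]
          gcongr
          intro e he
          simp only [hSc, Finset.mem_filter, Finset.mem_Icc] at he ⊢
          exact ⟨⟨he.1.1.1, Nat.le_floor he.2⟩, he.1.2⟩

lemma aux_image_ball (x ε : ℝ) : (fun y : ℝ => (y : UnitAddCircle)) '' Set.Ioo (x - ε) (x + ε) =
    Metric.ball (x : UnitAddCircle) ε := by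
  ext z
  induction z using QuotientAddGroup.induction_on with
  | H z =>
  rw [Metric.mem_ball, dist_eq_norm]
  constructor
  · rintro ⟨y, hy, h⟩
    have h' : ((y : ℝ) : UnitAddCircle) = (z : UnitAddCircle) := h
    change ‖(z : UnitAddCircle) - (x : UnitAddCircle)‖ < ε
    rw [← h', ← AddCircle.coe_sub]
    refine (QuotientAddGroup.norm_mk_le_norm).trans_lt ?_
    rw [Real.norm_eq_abs, abs_lt]
    constructor <;> linarith [hy.1, hy.2]
  · intro h
    change ‖(z : UnitAddCircle) - (x : UnitAddCircle)‖ < ε at h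
    rw [← AddCircle.coe_sub, UnitAddCircle.norm_eq, abs_lt] at h
    refine ⟨z - round (z - x), ⟨by linarith, by linarith⟩, ?_⟩
    change ((z - round (z-x) : ℝ) : UnitAddCircle) = (z : UnitAddCircle)
    rw [AddCircle.coe_sub, sub_eq_self]
    rw [AddCircle.coe_eq_zero_iff]
    exact ⟨round (z-x), by simp⟩

lemma aux_E_eq (ψ : ℕ → ℝ) (n : ℕ) : E ψ n = ⋃ a ∈ (Finset.Icc 1 n).filter (fun a => Nat.Coprime a n),
    Metric.ball (((a:ℝ)/n : ℝ) : UnitAddCircle) (ψ n / n) := by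
  unfold E
  simp only [sub_div, add_div, aux_image_ball]

lemma aux_vol_ball (x : UnitAddCircle) (ε : ℝ) (h : ε ≤ 1/2) :
    volume (Metric.ball x ε) = ENNReal.ofReal (2*ε) := by
  rw [← measure_congr (AddCircle.closedBall_ae_eq_ball), AddCircle.volume_closedBall, min_eq_right]
  linarith

lemma aux_card_tot (n : ℕ) (hn : 0 < n): ((Finset.Icc 1 n).filter (fun a => Nat.Coprime a n)).card = n.totient := by
  have h := Nat.filter_coprime_Ico_eq_totient n 1
  rw [← h]
  congr 1
  ext a
  simp [Nat.coprime_comm]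
  omega

lemma aux_volE (ψ : ℕ → ℝ) (n : ℕ) (hn : 0 < n) (h0 : 0 < ψ n) (h1 : ψ n ≤ 1/2) :
    (volume (E ψ n)).toReal = n.totient * (2 * (ψ n / n)) := by
  have hn1 : (1:ℝ) ≤ n := by exact_mod_cast hn
  have hn0 : (0:ℝ) < n := by linarith
  rw [aux_E_eq, measure_biUnion_finset]
  · have : ∀ a ∈ (Finset.Icc 1 n).filter (fun a => Nat.Coprime a n), volume (Metric.ball (((a:ℝ)/n : ℝ) : UnitAddCircle) (ψ n / n)) = ENNReal.ofReal (2*(ψ n / n)) := by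
      intro a _
      apply aux_vol_ball
      rw [div_le_iff₀ hn0]; linarith
    rw [Finset.sum_congr rfl this, Finset.sum_const, aux_card_tot n hn]
    rw [nsmul_eq_mul, ENNReal.toReal_mul, ENNReal.toReal_ofReal (by positivity)]
    simp
  · intro a ha b hb hab
    simp only [Finset.coe_filter, Finset.mem_Icc, Set.mem_ofPred_eq] at ha hb
    apply Metric.ball_disjoint_ball
    rw [dist_eq_norm, ← AddCircle.coe_sub, UnitAddCircle.norm_eq]
    set k := round ((a:ℝ)/n - b/n)
    have e : (a:ℝ)/n - b/n - k = (((a:ℤ) - b - k*n : ℤ) : ℝ)/n := by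
      push_cast; field_simp
    rw [e, abs_div, abs_of_pos hn0, ← add_div]
    apply div_le_div_of_nonneg_right _ hn0.le
    have hne : ((a:ℤ) - b - k*n : ℤ) ≠ 0 := by
      intro h
      have hk : k * n = a - b := by linarith
      have h3 : k * n < 1 * n := by omega
      have h4 : (-1) * n < k * n := by omega
      have hnn : (0:ℤ) < n := by exact_mod_cast hn
      have h5 := lt_of_mul_lt_mul_right h3 hnn.le
      have h6 := lt_of_mul_lt_mul_right h4 hnn.le
      have : k = 0 := by omega
      rw [this] at hk
      omega
    have := Int.one_le_abs hne
    have h2 : (1:ℝ) ≤ |(((a:ℤ) - b - k*n : ℤ) : ℝ)| := by exact_mod_cast this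
    linarith
  · intro a _; exact Metric.isOpen_ball.measurableSet

/-- pairs with close fractions -/
lemma aux_vol_inter (ψ : ℕ → ℝ) (m n : ℕ) (hm : 0 < m) (hn : 0 < n) (h0 : 0 < ψ m) (h1 : ψ m ≤ 1/2)
    (h0' : 0 < ψ n) (h1' : ψ n ≤ 1/2) (P : Finset (ℕ × ℕ))
    (hP : ∀ a b k : ℤ, ∀ a' b' : ℕ, (a = a') → b = b' → a' ∈ Finset.Icc 1 m → b' ∈ Finset.Icc 1 n → Nat.Coprime a' m → Nat.Coprime b' n →
      |(a:ℝ)/m - b/n - k| < 2 * max (ψ m / m) (ψ n / n) → (a', b') ∈ P) :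
    (volume (E ψ m ∩ E ψ n)).toReal ≤ P.card * (2 * min (ψ m / m) (ψ n / n)) := by
  have hm1 : (1:ℝ) ≤ m := by exact_mod_cast hm
  have hn1 : (1:ℝ) ≤ n := by exact_mod_cast hn
  have hn0 : (0:ℝ) < n := by linarith
  have hm0 : (0:ℝ) < m := by linarith
  have hsub : E ψ m ∩ E ψ n ⊆ ⋃ x ∈ P, (Metric.ball (((x.1:ℝ)/m : ℝ) : UnitAddCircle) (ψ m / m) ∩
      Metric.ball (((x.2:ℝ)/n : ℝ) : UnitAddCircle) (ψ n / n)) := by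
    rintro z ⟨hz1, hz2⟩
    rw [aux_E_eq] at hz1 hz2
    simp only [Set.mem_iUnion] at hz1 hz2 ⊢
    obtain ⟨a, ha, hza⟩ := hz1
    obtain ⟨b, hb, hzb⟩ := hz2
    refine ⟨(a,b), ?_, hza, hzb⟩
    have hd : dist (((a:ℝ)/m : ℝ) : UnitAddCircle) (((b:ℝ)/n : ℝ) : UnitAddCircle) < ψ m / m + ψ n / n := by
      refine (dist_triangle _ z _).trans_lt ?_
      rw [Metric.mem_ball] at hza hzb
      rw [dist_comm] at hza
      linarith
    rw [dist_eq_norm, ← AddCircle.coe_sub, UnitAddCircle.norm_eq] at hd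
    rw [Finset.mem_filter] at ha hb
    refine hP a b (round ((a:ℝ)/m - b/n)) a b rfl rfl ha.1 hb.1 ha.2 hb.2 ?_
    push_cast
    have := le_max_left (ψ m / m) (ψ n / n)
    have := le_max_right (ψ m / m) (ψ n / n)
    linarith
  have hmin0 : 0 ≤ min (ψ m / m) (ψ n / n) := by positivity
  have hv : volume (E ψ m ∩ E ψ n) ≤ P.card * ENNReal.ofReal (2 * min (ψ m / m) (ψ n / n)) := by
    refine (measure_mono hsub).trans ((measure_biUnion_finset_le _ _).trans ?_)
    rw [← nsmul_eq_mul]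
    apply Finset.sum_le_card_nsmul
    intro x _
    rcases le_total (ψ m / m) (ψ n / n) with h | h
    · rw [min_eq_left h, ← aux_vol_ball (((x.1:ℝ)/m : ℝ) : UnitAddCircle)]
      · exact measure_mono Set.inter_subset_left
      · rw [div_le_iff₀ hm0]; linarith
    · rw [min_eq_right h, ← aux_vol_ball (((x.2:ℝ)/n : ℝ) : UnitAddCircle)]
      · exact measure_mono Set.inter_subset_right
      · rw [div_le_iff₀ hn0]; linarith
  have := ENNReal.toReal_mono (by finiteness) hv
  rw [ENNReal.toReal_mul, ENNReal.toReal_ofReal (by positivity)] at this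
  simpa using this

lemma aux_card_isUnit (q : ℕ) [NeZero q] : Nat.card {x : ZMod q // IsUnit x} = q.totient := by
  rw [← ZMod.card_units_eq_totient, ← Nat.card_eq_fintype_card]
  refine Nat.card_congr (Equiv.symm (Equiv.ofBijective (fun u : (ZMod q)ˣ => (⟨u, u.isUnit⟩ : {x : ZMod q // IsUnit x})) ⟨?_, ?_⟩))
  · intro u v h
    simp only [Subtype.mk.injEq] at h
    exact Units.ext h
  · rintro ⟨x, u, hu⟩
    exact ⟨u, Subtype.ext hu⟩

noncomputable def auxF (r A : ℕ) (c : ℤ) : ℕ := Nat.card {x : ZMod r // IsUnit x ∧ IsUnit ((A:ZMod r) * x - (c : ZMod r))}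

lemma auxF_mul (a b A : ℕ) (c : ℤ) (h : Nat.Coprime a b) : auxF (a*b) A c = auxF a A c * auxF b A c := by
  unfold auxF
  rw [← Nat.card_prod]
  apply Nat.card_congr
  refine Equiv.trans ?_ Equiv.subtypeProdEquivProd
  refine (ZMod.chineseRemainder h).toEquiv.subtypeEquiv ?_
  intro x
  have h1 : IsUnit x ↔ IsUnit (ZMod.chineseRemainder h x) := (MulEquiv.isUnit_map _).symm
  have h2 : IsUnit ((A:ZMod (a*b)) * x - (c : ZMod (a*b))) ↔ IsUnit (ZMod.chineseRemainder h ((A:ZMod (a*b)) * x - (c : ZMod (a*b)))) := (MulEquiv.isUnit_map _).symm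
  rw [h1, h2, map_sub, map_mul, map_natCast, map_intCast, Prod.isUnit_iff, Prod.isUnit_iff]
  change _ ↔ (IsUnit (ZMod.chineseRemainder h x).1 ∧ _) ∧ (IsUnit (ZMod.chineseRemainder h x).2 ∧ _)
  simp only [Prod.fst_sub, Prod.snd_sub, Prod.fst_mul, Prod.snd_mul, Prod.fst_natCast, Prod.snd_natCast, Prod.fst_intCast, Prod.snd_intCast]
  change _ ↔ (_ ∧ IsUnit ((A:ZMod a) * (ZMod.chineseRemainder h x).1 - (c : ZMod a))) ∧ (_ ∧ IsUnit ((A:ZMod b) * (ZMod.chineseRemainder h x).2 - (c : ZMod b)))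
  tauto

lemma auxF_le (q A : ℕ) (hq : 0 < q) (c : ℤ) : auxF q A c ≤ q.totient := by
  have : NeZero q := ⟨hq.ne'⟩
  rw [← aux_card_isUnit]
  unfold auxF
  exact Nat.card_le_card_of_injective (fun x => (⟨x.1, x.2.1⟩ : {x : ZMod q // IsUnit x}))
    (by intro x y h; simp only [Subtype.mk.injEq] at h; exact Subtype.ext h)

lemma aux_unit_pow (p k : ℕ) (hp : p.Prime) (hk : 0 < k) (z : ℤ) : IsUnit (z : ZMod (p^k)) ↔ ¬ (p:ℤ) ∣ z := by
  rw [ZMod.coe_int_isUnit_iff_isCoprime]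
  push_cast
  rw [IsCoprime.pow_left_iff hk, Prime.coprime_iff_not_dvd (Nat.prime_iff_prime_int.1 hp)]

lemma auxF_pow (p k A : ℕ) (hp : p.Prime) (hk : 0 < k) (c : ℤ) (hA : Nat.Coprime A (p^k)) (hc : ¬ (p:ℤ) ∣ c) :
    auxF (p^k) A c + p^k = 2 * (p^k).totient := by
  classical
  have : NeZero (p^k) := ⟨(pow_pos hp.pos k).ne'⟩
  have hAu : IsUnit (A : ZMod (p^k)) := (ZMod.isUnit_iff_coprime _ _).2 hA
  set U := (Finset.univ : Finset (ZMod (p^k))).filter (fun x => IsUnit x) with hU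
  set V := (Finset.univ : Finset (ZMod (p^k))).filter (fun x => IsUnit ((A : ZMod (p^k)) * x - (c: ZMod (p^k)))) with hV
  have cU : U.card = (p^k).totient := by
    rw [← aux_card_isUnit, Nat.card_eq_fintype_card, Fintype.card_subtype]
  have cV : V.card = U.card := by
    apply Finset.card_bij (fun x _ => (A : ZMod (p^k)) * x - (c: ZMod (p^k)))
    · intro x hx; simpa [hU, hV] using hx
    · intro x _ y _ hxy
      exact hAu.mul_left_cancel (sub_left_inj.1 hxy)
    · intro y hy
      obtain ⟨u, hu⟩ := hAu
      refine ⟨(↑u⁻¹ : ZMod (p^k)) * (y + c), ?_, ?_⟩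
      · simp only [hV, Finset.mem_filter, Finset.mem_univ, true_and, ← hu, Units.mul_inv_cancel_left]
        simpa [hU] using hy
      · rw [← hu, Units.mul_inv_cancel_left]; ring
  have cI : auxF (p^k) A c = (U ∩ V).card := by
    unfold auxF
    rw [Nat.card_eq_fintype_card, Fintype.card_subtype, hU, hV, ← Finset.filter_and]
  have cUV : U ∪ V = Finset.univ := by
    rw [Finset.eq_univ_iff_forall]
    intro x
    simp only [hU, hV, Finset.mem_union, Finset.mem_filter, Finset.mem_univ, true_and]
    by_contra hcon
    push Not at hcon
    obtain ⟨x', rfl⟩ := ZMod.intCast_surjective x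
    have e : (A : ZMod (p^k)) * (x' : ZMod (p^k)) - (c : ZMod (p^k)) = ((A*x' - c : ℤ) : ZMod (p^k)) := by push_cast; ring
    rw [e, aux_unit_pow p k hp hk, aux_unit_pow p k hp hk, not_not, not_not] at hcon
    apply hc
    have := dvd_sub (Dvd.dvd.mul_left hcon.1 (A:ℤ)) hcon.2
    simpa using this
  have := Finset.card_union_add_card_inter U V
  rw [cUV, Finset.card_univ, ZMod.card, cV, cU, ← cI] at this
  omega

lemma auxF_bound (A : ℕ) (c : ℤ) (r : ℕ) : 0 < r → Nat.Coprime A r →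
    (auxF r A c : ℝ) * r * ∏ p ∈ r.primeFactors, (if (p:ℤ) ∣ c then (1 - 1/(p:ℝ)) else 1) ≤ (r.totient : ℝ)^2 := by
  induction r using Nat.recOnPosPrimePosCoprime with
  | zero => intro h; exact absurd h (lt_irrefl _)
  | one =>
    intro _ _
    have := auxF_le 1 A one_pos c
    simp at this ⊢
    exact this
  | prime_pow p n hp hn =>
    intro h0 hA
    rw [Nat.primeFactors_prime_pow hn.ne' hp, Finset.prod_singleton]
    have hp0 : (0:ℝ) < p := by exact_mod_cast hp.pos
    split_ifs with hc
    · have h1 : ((p^n).totient : ℝ) = (p^n:ℕ) * (1 - 1/(p:ℝ)) := by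
        have := Nat.totient_eq_mul_prod_factors (p^n)
        rw [Nat.primeFactors_prime_pow hn.ne' hp, Finset.prod_singleton] at this
        have h2 : (((p^n).totient : ℚ):ℝ) = (((p^n:ℕ) * (1 - (p:ℚ)⁻¹) : ℚ) : ℝ) := by rw [this]
        push_cast at h2
        push_cast
        rw [one_div]; exact h2
      rw [mul_assoc, ← h1, sq]
      gcongr
      exact auxF_le _ _ h0 _
    · have h := auxF_pow p n A hp hn c hA hc
      have h' : (auxF (p^n) A c : ℝ) + (p^n:ℕ) = 2 * (p^n).totient := by exact_mod_cast h
      have : (auxF (p^n) A c : ℝ) = 2 * (p^n).totient - (p^n:ℕ) := by linarith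
      rw [this]
      nlinarith [sq_nonneg (((p^n).totient:ℝ) - (p^n:ℕ))]
  | coprime a b ha hb hab iha ihb =>
    intro h0 hA
    have i1 := iha (by omega) (Nat.Coprime.coprime_mul_right_right hA)
    have i2 := ihb (by omega) (Nat.Coprime.coprime_mul_left_right hA)
    rw [Nat.Coprime.primeFactors_mul hab, Finset.prod_union hab.disjoint_primeFactors, auxF_mul a b A c hab, Nat.totient_mul hab]
    have hnn : ∀ s : ℕ, 0 ≤ ∏ p ∈ s.primeFactors, (if (p:ℤ) ∣ c then (1 - 1/(p:ℝ)) else 1) := by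
      intro s
      apply Finset.prod_nonneg
      intro p hp
      have : (1:ℝ) ≤ p := by exact_mod_cast (Nat.prime_of_mem_primeFactors hp).one_le
      split_ifs
      · rw [sub_nonneg, div_le_one (by linarith)]; exact this
      · norm_num
    have := mul_le_mul i1 i2 (mul_nonneg (by positivity) (hnn b)) (by positivity)
    push_cast
    refine le_trans (le_of_eq ?_) (this.trans (le_of_eq ?_)) <;> ring

lemma aux_w (r : ℕ) (c : ℤ) (hc : c ≠ 0) :
    1 ≤ (∏ p ∈ r.primeFactors, (if (p:ℤ) ∣ c then (1 - 1/(p:ℝ)) else 1)) * ∏ p ∈ c.natAbs.primeFactors, ((p:ℝ)/((p:ℝ)-1)) := by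
  rw [← Finset.prod_filter]
  have hg : ∀ p : ℕ, p.Prime → (1:ℝ) ≤ (p:ℝ)/((p:ℝ)-1) := by
    intro p hp
    have : (2:ℝ) ≤ p := by exact_mod_cast hp.two_le
    rw [le_div_iff₀ (by linarith)]; linarith
  have h1 : ∏ p ∈ r.primeFactors.filter (fun p : ℕ => (p:ℤ) ∣ c), ((p:ℝ)/((p:ℝ)-1)) ≤ ∏ p ∈ c.natAbs.primeFactors, ((p:ℝ)/((p:ℝ)-1)) := by
    apply Finset.prod_le_prod_of_subset_of_one_le
    · intro p hp
      rw [Finset.mem_filter] at hp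
      rw [Nat.mem_primeFactors]
      exact ⟨Nat.prime_of_mem_primeFactors hp.1, Int.natCast_dvd.1 hp.2, Int.natAbs_ne_zero.2 hc⟩
    · intro p hp; exact zero_le_one.trans (hg p (Nat.prime_of_mem_primeFactors (Finset.mem_filter.1 hp).1))
    · intro p hp _; exact hg p (Nat.prime_of_mem_primeFactors hp)
  have h2 : (∏ p ∈ r.primeFactors.filter (fun p : ℕ => (p:ℤ) ∣ c), (1 - 1/(p:ℝ))) * ∏ p ∈ r.primeFactors.filter (fun p : ℕ => (p:ℤ) ∣ c), ((p:ℝ)/((p:ℝ)-1)) = 1 := by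
    rw [← Finset.prod_mul_distrib]
    apply Finset.prod_eq_one
    intro p hp
    have : (2:ℝ) ≤ p := by exact_mod_cast (Nat.prime_of_mem_primeFactors (Finset.mem_filter.1 hp).1).two_le
    have h1 : (p:ℝ) - 1 ≠ 0 := by linarith
    field_simp
  refine h2.symm.le.trans ?_
  apply mul_le_mul_of_nonneg_left h1
  apply Finset.prod_nonneg
  intro p hp
  have : (1:ℝ) ≤ p := by exact_mod_cast (Nat.prime_of_mem_primeFactors (Finset.mem_filter.1 hp).1).one_le
  rw [sub_nonneg, div_le_one (by linarith)]; exact this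

lemma aux_Pc (r m1 m2 n1 n2 k1 k2 : ℕ) (hr : 0 < r) (hm1 : m1 = n1 * k1) (hn2 : n2 = m2 * k2)
    (hm1p : 0 < m1) (hn2p : 0 < n2)
    (c1 : Nat.Coprime r m1) (c2 : Nat.Coprime r n2) (c3 : Nat.Coprime m1 n2) (c : ℤ) (P : Finset (ℕ × ℕ))
    (hP : ∀ x ∈ P, x.1 ∈ Finset.Icc 1 (r*m1*m2) ∧ Nat.Coprime x.1 (r*m1*m2) ∧ x.2 ∈ Finset.Icc 1 (r*n1*n2) ∧
      Nat.Coprime x.2 (r*n1*n2) ∧ ((r*m1*n2 : ℕ):ℤ) ∣ (x.1*k2 - x.2 * k1 - c)) :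
    P.card ≤ auxF r k2 c * (n1.totient * m2.totient) := by
  classical
  have : NeZero r := ⟨hr.ne'⟩
  have hn1p : 0 < n1 := Nat.pos_of_ne_zero (by rintro rfl; simp at hm1; omega)
  have hm2p : 0 < m2 := Nat.pos_of_ne_zero (by rintro rfl; simp at hn2; omega)
  have c1k : Nat.Coprime r k1 := by rw [hm1] at c1; exact c1.coprime_mul_left_right
  have c1n : Nat.Coprime r n1 := by rw [hm1] at c1; exact c1.coprime_mul_right_right
  have c2k : Nat.Coprime r k2 := by rw [hn2] at c2; exact c2.coprime_mul_left_right
  have c2m : Nat.Coprime r m2 := by rw [hn2] at c2; exact c2.coprime_mul_right_right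
  have c3k : Nat.Coprime m1 k2 := by rw [hn2] at c3; exact c3.coprime_mul_left_right
  have c3m : Nat.Coprime m1 m2 := by rw [hn2] at c3; exact c3.coprime_mul_right_right
  have c4k : Nat.Coprime n2 k1 := by rw [hm1] at c3; exact c3.symm.coprime_mul_left_right
  have c4n : Nat.Coprime n1 n2 := by rw [hm1] at c3; exact c3.coprime_mul_right
  set T : Finset (ZMod r × ℕ × ℕ) := ((Finset.univ : Finset (ZMod r)).filter (fun x => IsUnit x ∧ IsUnit ((k2:ZMod r) * x - (c : ZMod r)))) ×ˢ
    (((Finset.range n1).filter n1.Coprime) ×ˢ ((Finset.range m2).filter m2.Coprime)) with hT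
  have cT : T.card = auxF r k2 c * (n1.totient * m2.totient) := by
    rw [hT, Finset.card_product, Finset.card_product, ← Nat.totient_eq_card_coprime, ← Nat.totient_eq_card_coprime]
    congr 1
    unfold auxF
    rw [Nat.card_eq_fintype_card, Fintype.card_subtype]
  rw [← cT]
  apply Finset.card_le_card_of_injOn (fun x => ((x.1 : ZMod r), x.2 % n1, x.1 % m2))
  · rintro ⟨a,b⟩ hx
    obtain ⟨h1, h2, h3, h4, h5⟩ := hP _ hx
    simp only at h1 h2 h3 h4 h5
    have har : Nat.Coprime a r := h2.coprime_mul_right_right.coprime_mul_right_right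
    have ham : Nat.Coprime a m2 := h2.coprime_mul_left_right
    have hbr : Nat.Coprime b r := h4.coprime_mul_right_right.coprime_mul_right_right
    have hbn : Nat.Coprime b n1 := h4.coprime_mul_right_right.coprime_mul_left_right
    simp only [hT, Finset.coe_product, Set.mem_prod, Finset.mem_coe, Finset.mem_filter, Finset.mem_univ, true_and, Finset.mem_range]
    refine ⟨⟨(ZMod.isUnit_iff_coprime _ _).2 har, ?_⟩, ⟨Nat.mod_lt _ hn1p, ?_⟩, ⟨Nat.mod_lt _ hm2p, ?_⟩⟩
    · have hd : ((r:ℕ):ℤ) ∣ (a*k2 - b * k1 - c) := dvd_trans ⟨m1*n2, by push_cast; ring⟩ h5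
      have := (ZMod.intCast_zmod_eq_zero_iff_dvd _ r).2 hd
      push_cast at this
      have e : (k2:ZMod r) * a - c = ((b*k1 : ℕ) : ZMod r) := by push_cast; linear_combination this
      rw [e, ZMod.isUnit_iff_coprime]
      exact Nat.Coprime.mul_left hbr c1k.symm
    · rw [Nat.coprime_comm]; unfold Nat.Coprime; rw [← Nat.gcd_rec, Nat.gcd_comm]; exact hbn
    · rw [Nat.coprime_comm]; unfold Nat.Coprime; rw [← Nat.gcd_rec, Nat.gcd_comm]; exact ham
  · rintro ⟨a,b⟩ hx ⟨a',b'⟩ hx' heq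
    obtain ⟨h1, h2, h3, h4, h5⟩ := hP _ hx
    obtain ⟨h1', h2', h3', h4', h5'⟩ := hP _ hx'
    simp only [Prod.mk.injEq] at h1 h3 h5 h1' h3' h5' heq
    obtain ⟨q1, q2, q3⟩ := heq
    have hD : ((r*m1*n2 : ℕ):ℤ) ∣ ((a:ℤ) - a')*k2 - (b - b') * k1 := by
      have := dvd_sub h5 h5'
      obtain ⟨w, hw⟩ := this; exact ⟨w, by linear_combination hw⟩
    have A_r : (r:ℤ) ∣ (a:ℤ) - a' := by
      have := (ZMod.natCast_eq_natCast_iff _ _ _).1 q1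
      exact (Nat.modEq_iff_dvd.1 this.symm)
    have B_n1 : (n1:ℤ) ∣ (b:ℤ) - b' := Nat.modEq_iff_dvd.1 (show b' ≡ b [MOD n1] from q2.symm)
    have A_m2 : (m2:ℤ) ∣ (a:ℤ) - a' := Nat.modEq_iff_dvd.1 (show a' ≡ a [MOD m2] from q3.symm)
    have B_r : (r:ℤ) ∣ (b:ℤ) - b' := by
      have hd : (r:ℤ) ∣ ((a:ℤ) - a')*k2 - (b - b') * k1 := dvd_trans ⟨m1*n2, by push_cast; ring⟩ hD
      have := dvd_sub (A_r.mul_right (k2:ℤ)) hd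
      have h : (r:ℤ) ∣ ((b:ℤ) - b') * k1 := by obtain ⟨w, hw⟩ := this; exact ⟨w, by linear_combination hw⟩
      exact (Nat.isCoprime_iff_coprime.2 c1k).dvd_of_dvd_mul_right h
    have A_m1 : (m1:ℤ) ∣ (a:ℤ) - a' := by
      have hd : (m1:ℤ) ∣ ((a:ℤ) - a')*k2 - (b - b') * k1 := dvd_trans ⟨r*n2, by push_cast; ring⟩ hD
      have hb : (m1:ℤ) ∣ ((b:ℤ) - b') * k1 := by rw [hm1]; push_cast; exact mul_dvd_mul_right B_n1 _
      have := dvd_add hd hb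
      have h : (m1:ℤ) ∣ ((a:ℤ) - a') * k2 := by obtain ⟨w, hw⟩ := this; exact ⟨w, by linear_combination hw⟩
      exact (Nat.isCoprime_iff_coprime.2 c3k).dvd_of_dvd_mul_right h
    have B_n2 : (n2:ℤ) ∣ (b:ℤ) - b' := by
      have hd : (n2:ℤ) ∣ ((a:ℤ) - a')*k2 - (b - b') * k1 := dvd_trans ⟨r*m1, by push_cast; ring⟩ hD
      have hb : (n2:ℤ) ∣ ((a:ℤ) - a') * k2 := by rw [hn2]; push_cast; exact mul_dvd_mul_right A_m2 _
      have := dvd_sub hb hd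
      have h : (n2:ℤ) ∣ ((b:ℤ) - b') * k1 := by obtain ⟨w, hw⟩ := this; exact ⟨w, by linear_combination hw⟩
      exact (Nat.isCoprime_iff_coprime.2 c4k).dvd_of_dvd_mul_right h
    have HA : ((r*m1*m2:ℕ):ℤ) ∣ (a:ℤ) - a' := by
      push_cast
      apply IsCoprime.mul_dvd _ _ A_m2
      · exact IsCoprime.mul_left (Nat.isCoprime_iff_coprime.2 c2m) (Nat.isCoprime_iff_coprime.2 c3m)
      · exact IsCoprime.mul_dvd (Nat.isCoprime_iff_coprime.2 c1) A_r A_m1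
    have HB : ((r*n1*n2:ℕ):ℤ) ∣ (b:ℤ) - b' := by
      push_cast
      apply IsCoprime.mul_dvd _ _ B_n2
      · exact IsCoprime.mul_left (Nat.isCoprime_iff_coprime.2 c2) (Nat.isCoprime_iff_coprime.2 c4n)
      · exact IsCoprime.mul_dvd (Nat.isCoprime_iff_coprime.2 c1n) B_r B_n1
    rw [Finset.mem_Icc] at h1 h1' h3 h3'
    have ea := Int.eq_zero_of_abs_lt_dvd HA (by rw [abs_lt]; constructor <;> omega)
    have eb := Int.eq_zero_of_abs_lt_dvd HB (by rw [abs_lt]; constructor <;> omega)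
    ext <;> simp only <;> omega

lemma aux_decomp (m n r t : ℕ) (hm : 0 < m) (hn : 0 < n)
    (hr : r = ∏ p ∈ (m * n).primeFactors.filter
          (fun p => m.factorization p = n.factorization p), p ^ m.factorization p)
    (ht : t = ∏ p ∈ (m * n).primeFactors.filter
          (fun p => m.factorization p ≠ n.factorization p),
          p ^ max (m.factorization p) (n.factorization p)) :
    ∃ m1 m2 n1 n2 k1 k2 : ℕ, m = r*m1*m2 ∧ n = r*n1*n2 ∧ m1 = n1*k1 ∧ n2 = m2*k2 ∧ t = m1*n2 ∧
      Nat.Coprime r m1 ∧ Nat.Coprime r n2 ∧ Nat.Coprime m1 n2 ∧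
      (∀ p : ℕ, p.Prime → p ∣ m1 → p ∣ k1) ∧ (∀ p : ℕ, p.Prime → p ∣ n2 → p ∣ k2) := by
  set s := (m*n).primeFactors with hs
  set u := fun p => m.factorization p with hu
  set v := fun p => n.factorization p with hv
  have hsp : ∀ p ∈ s, p.Prime := fun p hp => Nat.prime_of_mem_primeFactors hp
  have em : m = ∏ p ∈ s, p ^ u p := by
    conv_lhs => rw [← Nat.prod_factorization_pow_eq_self hm.ne']
    rw [Finsupp.prod_of_support_subset (s := s)]
    · rw [Nat.support_factorization]
      exact Nat.primeFactors_mono (dvd_mul_right _ _) (by positivity)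
    · simp
  have en : n = ∏ p ∈ s, p ^ v p := by
    conv_lhs => rw [← Nat.prod_factorization_pow_eq_self hn.ne']
    rw [Finsupp.prod_of_support_subset (s := s)]
    · rw [Nat.support_factorization]
      exact Nat.primeFactors_mono (dvd_mul_left _ _) (by positivity)
    · simp
  have hsplit : ∀ f : ℕ → ℕ, ∏ p ∈ s, f p = (∏ p ∈ s.filter (fun p => u p = v p), f p) *
      (∏ p ∈ s.filter (fun p => v p < u p), f p) * (∏ p ∈ s.filter (fun p => u p < v p), f p) := by
    intro f
    rw [Finset.prod_filter, Finset.prod_filter, Finset.prod_filter, ← Finset.prod_mul_distrib, ← Finset.prod_mul_distrib]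
    apply Finset.prod_congr rfl
    intro p _
    rcases lt_trichotomy (u p) (v p) with h | h | h
    · simp [h, h.ne, h.le]
    · simp [h]
    · simp [h, h.ne', h.le]
  have hcop : ∀ (s1 s2 : Finset ℕ) (f g : ℕ → ℕ), s1 ⊆ s → s2 ⊆ s → Disjoint s1 s2 →
      Nat.Coprime (∏ p ∈ s1, p ^ f p) (∏ p ∈ s2, p ^ g p) := by
    intro s1 s2 f g h1 h2 hd
    apply Nat.Coprime.prod_left
    intro p hp
    apply Nat.Coprime.prod_right
    intro q hq
    apply Nat.Coprime.pow
    rw [Nat.coprime_primes (hsp p (h1 hp)) (hsp q (h2 hq))]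
    rintro rfl
    exact Finset.disjoint_left.1 hd hp hq
  have hdv : ∀ (s1 : Finset ℕ) (f g : ℕ → ℕ), s1 ⊆ s → (∀ p ∈ s1, 0 < g p) → ∀ p : ℕ, p.Prime →
      p ∣ ∏ q ∈ s1, q ^ f q → p ∣ ∏ q ∈ s1, q ^ g q := by
    intro s1 f g h1 h2 p hp hd
    obtain ⟨q, hq, hpq⟩ := (Prime.dvd_finsetProd_iff (Nat.prime_iff.1 hp) _).1 hd
    have : p = q := (Nat.prime_dvd_prime_iff_eq hp (hsp q (h1 hq))).1 (hp.dvd_of_dvd_pow hpq)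
    subst this
    exact (dvd_pow_self p (h2 p hq).ne').trans (Finset.dvd_prod_of_mem (fun q => q ^ g q) hq)
  have dis : ∀ (P Q : ℕ → Prop) [DecidablePred P] [DecidablePred Q], (∀ p, P p → ¬ Q p) →
      Disjoint (s.filter P) (s.filter Q) := by
    intro P Q _ _ h
    rw [Finset.disjoint_left]
    intro p h1 h2
    exact h p (Finset.mem_filter.1 h1).2 (Finset.mem_filter.1 h2).2
  refine ⟨∏ p ∈ s.filter (fun p => v p < u p), p ^ u p, ∏ p ∈ s.filter (fun p => u p < v p), p ^ u p,
    ∏ p ∈ s.filter (fun p => v p < u p), p ^ v p, ∏ p ∈ s.filter (fun p => u p < v p), p ^ v p,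
    ∏ p ∈ s.filter (fun p => v p < u p), p ^ (u p - v p), ∏ p ∈ s.filter (fun p => u p < v p), p ^ (v p - u p),
    ?_, ?_, ?_, ?_, ?_, ?_, ?_, ?_, ?_, ?_⟩
  · rw [hr]; conv_lhs => rw [em]
    exact hsplit _
  · have hr' : r = ∏ p ∈ s.filter (fun p => u p = v p), p ^ v p := by
      rw [hr]
      apply Finset.prod_congr rfl
      intro p hp
      have : u p = v p := (Finset.mem_filter.1 hp).2
      change p ^ u p = _
      rw [this]
    rw [hr']; conv_lhs => rw [en]
    exact hsplit _
  · rw [← Finset.prod_mul_distrib]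
    apply Finset.prod_congr rfl
    intro p hp
    have := (Finset.mem_filter.1 hp).2
    rw [← pow_add]; congr 1; omega
  · rw [← Finset.prod_mul_distrib]
    apply Finset.prod_congr rfl
    intro p hp
    have := (Finset.mem_filter.1 hp).2
    rw [← pow_add]; congr 1; omega
  · rw [ht, Finset.prod_filter, Finset.prod_filter, Finset.prod_filter, ← Finset.prod_mul_distrib]
    apply Finset.prod_congr rfl
    intro p _
    change (if u p ≠ v p then p ^ max (u p) (v p) else 1) = _
    rcases lt_trichotomy (u p) (v p) with h | h | h
    · simp [h, h.ne, h.le]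
    · simp [h]
    · simp [h, h.ne', h.le]
  · rw [hr]; exact hcop _ _ _ _ (Finset.filter_subset _ _) (Finset.filter_subset _ _) (dis _ _ (fun p h h' => by simp only [hu, hv] at h'; omega))
  · rw [hr]; exact hcop _ _ _ _ (Finset.filter_subset _ _) (Finset.filter_subset _ _) (dis _ _ (fun p h h' => by simp only [hu, hv] at h'; omega))
  · exact hcop _ _ _ _ (Finset.filter_subset _ _) (Finset.filter_subset _ _) (dis _ _ (fun p h h' => by omega))
  · exact hdv _ _ _ (Finset.filter_subset _ _) (fun p hp => by have := (Finset.mem_filter.1 hp).2; omega)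
  · exact hdv _ _ _ (Finset.filter_subset _ _) (fun p hp => by have := (Finset.mem_filter.1 hp).2; omega)

lemma aux_cop (r m1 m2 n1 n2 k1 k2 a b : ℕ) (hm1 : m1 = n1 * k1) (hn2 : n2 = m2 * k2)
    (c3 : Nat.Coprime m1 n2)
    (d1 : ∀ p : ℕ, p.Prime → p ∣ m1 → p ∣ k1) (d2 : ∀ p : ℕ, p.Prime → p ∣ n2 → p ∣ k2)
    (ha : Nat.Coprime a (r*m1*m2)) (hb : Nat.Coprime b (r*n1*n2)) (c : ℤ)
    (hc : ((r*m1*n2 : ℕ):ℤ) ∣ (a*k2 - b * k1 - c)) : Nat.Coprime c.natAbs (m1*n2) := by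
  rw [Nat.coprime_iff_gcd_eq_one] at *
  by_contra hne
  obtain ⟨p, hp, hpd⟩ := Nat.exists_prime_and_dvd hne
  have hpc : (p:ℤ) ∣ c := Int.natCast_dvd.2 (hpd.trans (Nat.gcd_dvd_left _ _))
  have hpt : p ∣ m1 * n2 := hpd.trans (Nat.gcd_dvd_right _ _)
  have hpi : Prime (p:ℤ) := Nat.prime_iff_prime_int.1 hp
  have hpL : (p:ℤ) ∣ (a*k2 - b * k1 - c) := by
    refine dvd_trans (Int.natCast_dvd_natCast.2 (hpt.trans ⟨r, by ring⟩)) hc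
  have hpD : (p:ℤ) ∣ a*k2 - b*k1 := by
    have := dvd_add hpL hpc
    simpa using this
  rcases (Nat.Prime.dvd_mul hp).1 hpt with h | h
  · have h1 : (p:ℤ) ∣ b*k1 := (Int.natCast_dvd_natCast.2 (d1 p hp h)).mul_left _
    have h2 : (p:ℤ) ∣ ((a*k2 : ℕ):ℤ) := by
      have := dvd_add hpD h1
      push_cast; simpa using this
    rcases (Nat.Prime.dvd_mul hp).1 (Int.natCast_dvd_natCast.1 h2) with h3 | h3
    · exact Nat.not_coprime_of_dvd_of_dvd hp.one_lt h3 (h.trans ⟨r*m2, by ring⟩) ha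
    · exact Nat.not_coprime_of_dvd_of_dvd hp.one_lt h (h3.trans ⟨m2, by rw [hn2]; ring⟩) c3
  · have h1 : (p:ℤ) ∣ a*k2 := (Int.natCast_dvd_natCast.2 (d2 p hp h)).mul_left _
    have h2 : (p:ℤ) ∣ ((b*k1 : ℕ):ℤ) := by
      have := dvd_sub h1 hpD
      push_cast; simpa using this
    rcases (Nat.Prime.dvd_mul hp).1 (Int.natCast_dvd_natCast.1 h2) with h3 | h3
    · exact Nat.not_coprime_of_dvd_of_dvd hp.one_lt h3 (h.trans ⟨r*n1, by ring⟩) hb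
    · exact Nat.not_coprime_of_dvd_of_dvd hp.one_lt (h3.trans ⟨n1, by rw [hm1]; ring⟩) h c3

/-- Normalized overlap estimate in integral form:
`P(m,n) ≪ (t/φ(t)) · (1/(Δrt)) · ∫_1^{4Δrt} S_t(θ) dθ`. -/
theorem normalized_overlap_integral_bound :
    ∃ C : ℝ, 0 < C ∧ ∀ (ψ : ℕ → ℝ), (∀ j, 0 ≤ ψ j) →
      ∀ (m n : ℕ), 0 < m → 0 < n → m ≠ n →
      0 < ψ m → ψ m ≤ 1 / 2 → 0 < ψ n → ψ n ≤ 1 / 2 →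
      ∀ (r t : ℕ),
      r = ∏ p ∈ (m * n).primeFactors.filter
          (fun p => m.factorization p = n.factorization p), p ^ m.factorization p →
      t = ∏ p ∈ (m * n).primeFactors.filter
          (fun p => m.factorization p ≠ n.factorization p),
          p ^ max (m.factorization p) (n.factorization p) →
      (volume (E ψ m ∩ E ψ n)).toReal /
          ((volume (E ψ m)).toReal * (volume (E ψ n)).toReal) ≤
        C * ((t : ℝ) / Nat.totient t) *
          (1 / (max (ψ m / m) (ψ n / n) * r * t)) *
          ∫ θ in (1 : ℝ)..(max 1 (4 * max (ψ m / m) (ψ n / n) * r * t)), S t θ := by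
  refine ⟨4, by norm_num, ?_⟩
  intro ψ _ m n hm hn hmn h0 h1 h0' h1' r t hr ht
  obtain ⟨m1, m2, n1, n2, k1, k2, em, en, hm1, hn2, et, c1, c2, c3, d1, d2⟩ := aux_decomp m n r t hm hn hr ht
  clear hr ht
  have hrp : 0 < r := Nat.pos_of_ne_zero (by rintro rfl; simp at em; omega)
  have hm1p : 0 < m1 := Nat.pos_of_ne_zero (by rintro rfl; simp at em; omega)
  have hm2p : 0 < m2 := Nat.pos_of_ne_zero (by rintro rfl; simp at em; omega)
  have hn1p : 0 < n1 := Nat.pos_of_ne_zero (by rintro rfl; simp at en; omega)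
  have hn2p : 0 < n2 := Nat.pos_of_ne_zero (by rintro rfl; simp at en; omega)
  have htp : 0 < t := by rw [et]; positivity
  have ht1 : t ≠ 1 := by
    intro h
    rw [h] at et
    obtain ⟨e1, e2⟩ := mul_eq_one.1 et.symm
    have e3 : n1 = 1 := (mul_eq_one.1 (hm1.symm.trans e1)).1
    have e4 : m2 = 1 := (mul_eq_one.1 (hn2.symm.trans e2)).1
    apply hmn
    rw [em, en, e1, e2, e3, e4]
  have eL1 : r * m1 * n2 = m * k2 := by rw [em, hn2]; ring
  have eL2 : r * m1 * n2 = n * k1 := by rw [en, hm1]; ring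
  have eLt : r * m1 * n2 = r * t := by rw [et]; ring
  set Δ := max (ψ m / m) (ψ n / n) with hΔ
  set δ := min (ψ m / m) (ψ n / n) with hδ
  have hmR : (0:ℝ) < m := by exact_mod_cast hm
  have hnR : (0:ℝ) < n := by exact_mod_cast hn
  have hrR : (0:ℝ) < r := by exact_mod_cast hrp
  have htR : (0:ℝ) < t := by exact_mod_cast htp
  have hΔ0 : 0 < Δ := lt_max_of_lt_left (by positivity)
  have hδ0 : 0 < δ := lt_min (by positivity) (by positivity)
  have hΔδ : (ψ m / m) * (ψ n / n) = Δ * δ := (max_mul_min _ _).symm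
  set X := 2 * Δ * r * t with hX
  have hX0 : 0 ≤ X := by positivity
  have eX : 4 * Δ * r * t = 2 * X := by rw [hX]; ring
  rw [eX]
  have hI := aux_L2 t X hX0
  set I := ∫ θ in (1:ℝ)..(max 1 (2*X)), S t θ with hIdef
  set Sc := (Finset.Icc 1 ⌊X⌋₊).filter (fun c => Nat.Coprime c t) with hSc
  set Pc : ℤ → Finset (ℕ × ℕ) := fun c => ((Finset.Icc 1 m) ×ˢ (Finset.Icc 1 n)).filter
    (fun x => Nat.Coprime x.1 m ∧ Nat.Coprime x.2 n ∧ ((r*m1*n2 : ℕ):ℤ) ∣ (x.1*k2 - x.2 * k1 - c)) with hPc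
  have hφt : (0:ℝ) < t.totient := by exact_mod_cast Nat.totient_pos.2 htp
  have hφm : (0:ℝ) < m.totient := by exact_mod_cast Nat.totient_pos.2 hm
  have hφn : (0:ℝ) < n.totient := by exact_mod_cast Nat.totient_pos.2 hn
  have eφ : (m.totient : ℝ) * n.totient = r.totient^2 * t.totient * (n1.totient * m2.totient) := by
    have q1 : m.totient = r.totient * m1.totient * m2.totient := by
      rw [em, Nat.totient_mul, Nat.totient_mul c1]
      rw [hn2] at c2 c3
      exact Nat.Coprime.mul_left c2.coprime_mul_right_right c3.coprime_mul_right_right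
    have q2 : n.totient = r.totient * n1.totient * n2.totient := by
      rw [hm1] at c1 c3
      rw [en, Nat.totient_mul, Nat.totient_mul c1.coprime_mul_right_right]
      exact Nat.Coprime.mul_left c2 c3.coprime_mul_right
    have q3 : t.totient = m1.totient * n2.totient := by rw [et, Nat.totient_mul c3]
    rw [q1, q2, q3]; push_cast; ring
  set K : ℝ := (m.totient : ℝ) * n.totient / (t.totient * r) with hK
  have hK0 : 0 < K := by positivity
  have hbound : ∀ c : ℤ, c ≠ 0 → ((Pc c).card : ℝ) ≤ K * ∏ p ∈ c.natAbs.primeFactors, ((p:ℝ)/((p:ℝ)-1)) := by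
    intro c hc
    have b1 : (Pc c).card ≤ auxF r k2 c * (n1.totient * m2.totient) := by
      apply aux_Pc r m1 m2 n1 n2 k1 k2 hrp hm1 hn2 hm1p hn2p c1 c2 c3
      intro x hx
      rw [← em, ← en]
      simp only [hPc, Finset.mem_filter, Finset.mem_product] at hx
      exact ⟨hx.1.1, hx.2.1, hx.1.2, hx.2.2.1, hx.2.2.2⟩
    have b1' : ((Pc c).card : ℝ) ≤ auxF r k2 c * (n1.totient * m2.totient) := by exact_mod_cast b1
    have ck : Nat.Coprime k2 r := by rw [hn2] at c2; exact c2.coprime_mul_left_right.symm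
    have b2 := auxF_bound k2 c r hrp ck
    have b3 := aux_w r c hc
    set w := ∏ p ∈ r.primeFactors, (if (p:ℤ) ∣ c then (1 - 1/(p:ℝ)) else 1)
    set g := ∏ p ∈ c.natAbs.primeFactors, ((p:ℝ)/((p:ℝ)-1)) with hg
    have hg0 : 0 ≤ g := by
      apply Finset.prod_nonneg
      intro p hp
      have : (1:ℝ) ≤ p := by exact_mod_cast (Nat.prime_of_mem_primeFactors hp).one_le
      exact div_nonneg (by linarith) (by linarith)
    have eK : K = r.totient^2 * (n1.totient * m2.totient) / r := by
      rw [hK, eφ]; field_simp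
    rw [eK]
    have b4 : (auxF r k2 c : ℝ) ≤ r.totient^2 / r * g := by
      rw [div_mul_eq_mul_div, le_div_iff₀ hrR]
      calc (auxF r k2 c : ℝ) * r ≤ auxF r k2 c * r * (w * g) := le_mul_of_one_le_right (by positivity) b3
        _ = (auxF r k2 c * r * w) * g := by ring
        _ ≤ _ := by gcongr
    calc _ ≤ (auxF r k2 c : ℝ) * (n1.totient * m2.totient) := b1'
      _ ≤ (r.totient^2 / r * g) * (n1.totient * m2.totient) := by gcongr
      _ = _ := by ring
  set P := Sc.biUnion (fun c => Pc (c:ℤ) ∪ Pc (-(c:ℤ))) with hP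
  have hPcard : (P.card : ℝ) * Real.log 2 ≤ 4 * K * I := by
    have a1 : (P.card : ℝ) ≤ ∑ c ∈ Sc, (((Pc (c:ℤ)).card : ℝ) + (Pc (-(c:ℤ))).card) := by
      have : P.card ≤ ∑ c ∈ Sc, ((Pc (c:ℤ)).card + (Pc (-(c:ℤ))).card) :=
        Finset.card_biUnion_le.trans (Finset.sum_le_sum fun c _ => Finset.card_union_le _ _)
      exact_mod_cast this
    have a2 : (P.card : ℝ) ≤ ∑ c ∈ Sc, 4 * K * ∑ d ∈ c.divisors, (1:ℝ)/d := by
      refine a1.trans (Finset.sum_le_sum ?_)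
      intro c hc
      simp only [hSc, Finset.mem_filter, Finset.mem_Icc] at hc
      have hcp : 0 < c := hc.1.1
      have x1 := hbound (c:ℤ) (by exact_mod_cast hcp.ne')
      have x2 := hbound (-(c:ℤ)) (by rw [neg_ne_zero]; exact_mod_cast hcp.ne')
      rw [Int.natAbs_neg] at x2
      rw [Int.natAbs_natCast] at x1 x2
      have x3 := mul_le_mul_of_nonneg_left (aux_L1 c hcp) hK0.le
      linarith
    rw [← Finset.mul_sum] at a2
    have hl2 : 0 < Real.log 2 := Real.log_pos (by norm_num)
    calc _ ≤ (4 * K * ∑ c ∈ Sc, ∑ d ∈ c.divisors, (1:ℝ)/d) * Real.log 2 := by gcongr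
      _ = 4 * K * (Real.log 2 * ∑ c ∈ Sc, ∑ d ∈ c.divisors, (1:ℝ)/d) := by ring
      _ ≤ _ := by gcongr
  have hvol := aux_vol_inter ψ m n hm hn h0 h1 h0' h1' P (by
    rintro _ _ k a b rfl rfl ha hb hac hbc habs
    set c : ℤ := a * k2 - b * k1 - k * (r*m1*n2 : ℕ) with hc
    have hdvd : ((r*m1*n2 : ℕ):ℤ) ∣ (a*k2 - b * k1 - c) := ⟨k, by rw [hc]; ring⟩
    have hcop : Nat.Coprime c.natAbs t := by
      rw [et]
      exact aux_cop r m1 m2 n1 n2 k1 k2 a b hm1 hn2 c3 d1 d2 (em ▸ hac) (en ▸ hbc) c hdvd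
    have hc0 : c.natAbs ≠ 0 := by
      intro h
      rw [h, Nat.coprime_zero_left] at hcop
      exact ht1 hcop
    have eL1' : ((r*m1*n2 : ℕ):ℝ) = m * k2 := by exact_mod_cast eL1
    have eL2' : ((r*m1*n2 : ℕ):ℝ) = n * k1 := by exact_mod_cast eL2
    have eLt' : ((r*m1*n2 : ℕ):ℝ) = r * t := by exact_mod_cast eLt
    have ecR : (c:ℝ) = ((a:ℤ):ℝ)/m * (m * k2) - ((b:ℤ):ℝ)/n * (n*k1) - k * ((r*m1*n2 : ℕ):ℝ) := by
      rw [hc]; push_cast; field_simp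
    rw [← eL1', ← eL2'] at ecR
    have ecR2 : (c:ℝ) = (((a:ℤ):ℝ)/m - ((b:ℤ):ℝ)/n - k) * (r * t) := by rw [ecR, eLt']; ring
    have hcX : (c.natAbs : ℝ) ≤ X := by
      rw [Nat.cast_natAbs, Int.cast_abs, ecR2, abs_mul, abs_of_pos (mul_pos hrR htR), hX]
      have := mul_le_mul_of_nonneg_right habs.le (mul_pos hrR htR).le
      linarith
    rw [hP, Finset.mem_biUnion]
    refine ⟨c.natAbs, ?_, ?_⟩
    · rw [hSc, Finset.mem_filter, Finset.mem_Icc]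
      exact ⟨⟨Nat.pos_of_ne_zero hc0, Nat.le_floor hcX⟩, hcop⟩
    · have hmem : (a,b) ∈ Pc c := by
        simp only [hPc, Finset.mem_filter, Finset.mem_product]
        exact ⟨⟨ha, hb⟩, hac, hbc, hdvd⟩
      rw [Finset.mem_union]
      rcases Int.natAbs_eq c with h | h
      · left; rw [← h]; exact hmem
      · right; rw [← h]; exact hmem)
  rw [aux_volE ψ m hm h0 h1, aux_volE ψ n hn h0' h1']
  have hl2 : 1/2 ≤ Real.log 2 := by have := Real.log_two_gt_d9; linarith
  have hP8 : (P.card : ℝ) ≤ 8 * K * I := by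
    have : (P.card : ℝ) * (1/2) ≤ P.card * Real.log 2 := by gcongr
    linarith
  have eden : (m.totient : ℝ) * (2 * (ψ m / m)) * (n.totient * (2 * (ψ n / n))) = 4 * (m.totient * n.totient) * (Δ * δ) := by
    rw [← hΔδ]; ring
  rw [eden, div_le_iff₀ (by positivity)]
  calc _ ≤ (P.card : ℝ) * (2 * δ) := hvol
    _ ≤ (8 * K * I) * (2 * δ) := by gcongr
    _ = _ := by
      rw [hK]
      field_simp
      ring
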